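/- arXiv:2401.07147 — 3 statements merged into one kernel-verified Lean document; each statement's English description precedes it below -/
import Mathlib

section
/- Let (B_n) be a sequence with B_n ⊆ {0,1}^n such that |B_n| ≤ c·n for some constant c > 0 (for all sufficiently large n), and such that |SP(B_n)| ∈ Θ(n), i.e., there are constants 0 < c₁ ≤ c₂ with c₁·n ≤ |SP(B_n)| ≤ c₂·n for all sufficiently large n. Then |Orbit_n(B_n)| grows faster than any polynomial in 2^n; precisely, for every k ∈ ℕ and every real C > 0 there exists n with |Orbit_n(B_n)| > C · 2^{k·n}. -/
/-- Binary strings of length `n`: the set `{0,1}ⁿ`. -/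
abbrev Str (n : ℕ) := Fin n → Bool

/-- The action of `Sym_n` on strings, permuting positions: `(π·v)_i = v_{π⁻¹(i)}`. -/
def act {n : ℕ} (π : Equiv.Perm (Fin n)) (v : Str n) : Str n := fun i => v (π.symm i)

/-- The action of `Sym_n` on sets of strings. -/
def actSet {n : ℕ} (π : Equiv.Perm (Fin n)) (C : Set (Str n)) : Set (Str n) := act π '' C

/-- The (setwise) stabiliser of a set of strings. -/
def setStab {n : ℕ} (C : Set (Str n)) : Set (Equiv.Perm (Fin n)) := {π | actSet π C = C}

/-- The orbit of a set of strings under `Sym_n`. -/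
def setOrbit {n : ℕ} (C : Set (Str n)) : Set (Set (Str n)) := {D | ∃ π, D = actSet π C}

/-- An ordered partition of `{0,1}ⁿ`: a tuple of pairwise disjoint nonempty subsets
whose union is everything. -/
def IsOrderedPartition {n m : ℕ} (C : Fin m → Set (Str n)) : Prop :=
  (∀ i, (C i).Nonempty) ∧ (Pairwise fun i j => Disjoint (C i) (C j)) ∧ (⋃ i, C i) = Set.univ

/-- The stabiliser of an ordered partition (componentwise). -/
def tupStab {n m : ℕ} (C : Fin m → Set (Str n)) : Set (Equiv.Perm (Fin n)) :=
  {π | ∀ i, actSet π (C i) = C i}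

/-- The orbit of an ordered partition under the componentwise action of `Sym_n`. -/
def tupOrbit {n m : ℕ} (C : Fin m → Set (Str n)) : Set (Fin m → Set (Str n)) :=
  {D | ∃ π, D = fun i => actSet π (C i)}

/-- Pointwise stabiliser of a partition (setoid) of `[n]`: permutations fixing
each part setwise. -/
def ptStab {n : ℕ} (s : Setoid (Fin n)) : Set (Equiv.Perm (Fin n)) :=
  {π | ∀ P ∈ s.classes, (π : Fin n → Fin n) '' P = P}

/-- Setwise stabiliser of a partition of `[n]`: permutations mapping parts to parts. -/
def swStab {n : ℕ} (s : Setoid (Fin n)) : Set (Equiv.Perm (Fin n)) :=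
  {π | ∀ P ∈ s.classes, (π : Fin n → Fin n) '' P ∈ s.classes}

/-- A partition `s` of `[n]` is a supporting partition of `G` if its pointwise
stabiliser is contained in `G`. -/
def IsSupporting {n : ℕ} (G : Set (Equiv.Perm (Fin n))) (s : Setoid (Fin n)) : Prop :=
  ∀ π ∈ ptStab s, π ∈ G

/-- `s` is as coarse as `t`: every part of `t` is contained in some part of `s`. -/
def AsCoarseAs {X : Type*} (s t : Setoid X) : Prop :=
  ∀ P ∈ t.classes, ∃ Q ∈ s.classes, P ⊆ Q

/-- `s` is the coarsest supporting partition of `G`. -/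
def IsCoarsestSupp {n : ℕ} (G : Set (Equiv.Perm (Fin n))) (s : Setoid (Fin n)) : Prop :=
  IsSupporting G s ∧ ∀ t, IsSupporting G t → AsCoarseAs s t

/-- The intersection `⊓_{a ∈ A} f(a)` of a family of partitions: parts are the
nonempty intersections of parts. -/
def interSetoid {X ι : Type*} (A : Set ι) (f : ι → Setoid X) : Setoid X where
  r x y := ∀ a ∈ A, (f a).r x y
  iseqv := ⟨fun x a _ => (f a).refl x,
            fun h a ha => (f a).symm (h a ha),
            fun h h' a ha => (f a).trans (h a ha) (h' a ha)⟩

/-- `SP(a)` for a string `a`: the partition of positions according to the bit of `a`. -/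
def strSetoid {n : ℕ} (a : Str n) : Setoid (Fin n) where
  r k j := a k = a j
  iseqv := ⟨fun _ => rfl, Eq.symm, Eq.trans⟩

/-- `π ∈ Sym_n` realises a permutation `σ` of the parts of a partition `s` if
`π(P) = σ(P)` for every part `P`. -/
def Realises {n : ℕ} (π : Equiv.Perm (Fin n)) {s : Setoid (Fin n)}
    (σ : Equiv.Perm s.classes) : Prop :=
  ∀ P : s.classes, (π : Fin n → Fin n) '' (P : Set (Fin n)) = ((σ P : Set (Fin n)))

namespace Aux11

theorem act_mul {n : ℕ} (p q : Equiv.Perm (Fin n)) (v : Str n) :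
    act (p * q) v = act p (act q v) := rfl

theorem actSet_mul {n : ℕ} (p q : Equiv.Perm (Fin n)) (C : Set (Str n)) :
    actSet (p * q) C = actSet p (actSet q C) := by
  unfold actSet
  rw [Set.image_image]
  rfl

theorem actSet_one {n : ℕ} (C : Set (Str n)) : actSet 1 C = C := by
  have : act (1 : Equiv.Perm (Fin n)) = id := rfl
  unfold actSet
  rw [this, Set.image_id]

theorem stab_mul {n : ℕ} {C : Set (Str n)} {p q : Equiv.Perm (Fin n)}
    (hp : p ∈ setStab C) (hq : q ∈ setStab C) : p * q ∈ setStab C := by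
  change actSet (p * q) C = C
  rw [actSet_mul, show actSet q C = C from hq, show actSet p C = C from hp]

theorem stab_inv {n : ℕ} {C : Set (Str n)} {p : Equiv.Perm (Fin n)}
    (hp : p ∈ setStab C) : p⁻¹ ∈ setStab C := by
  change actSet p⁻¹ C = C
  have hp' : actSet p C = C := hp
  calc actSet p⁻¹ C = actSet p⁻¹ (actSet p C) := by rw [hp']
    _ = C := by rw [← actSet_mul, inv_mul_cancel, actSet_one]

theorem stab_mem {n : ℕ} {C : Set (Str n)} {p : Equiv.Perm (Fin n)}
    (hp : p ∈ setStab C) {b : Str n} (hb : b ∈ C) : act p b ∈ C := by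
  have hp' : actSet p C = C := hp
  rw [← hp']
  exact ⟨b, hb, rfl⟩

theorem swap_of_three {n : ℕ} {C : Set (Str n)} {p : Equiv.Perm (Fin n)}
    (hp : p ∈ setStab C) {x q r : Fin n} (hxq : x ≠ q) (hxr : x ≠ r) (hqr : q ≠ r)
    (h1 : p x = q) (h2 : p q = r) (h3 : p r = x)
    (h4 : ∀ z, z ≠ x → z ≠ q → z ≠ r → p z = z) : Equiv.swap x q ∈ setStab C := by
  have key : ∀ b ∈ C, act (Equiv.swap x q) b ∈ C := by
    intro b hb
    have e1 : p.symm q = x := by rw [← h1]; simp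
    have e2 : p.symm r = q := by rw [← h2]; simp
    have e3 : p.symm x = r := by rw [← h3]; simp
    have e4 : ∀ z, z ≠ x → z ≠ q → z ≠ r → p.symm z = z := fun z a b c => by
      rw [Equiv.symm_apply_eq, h4 z a b c]
    have s1 : (Equiv.swap x q) x = q := Equiv.swap_apply_left _ _
    have s2 : (Equiv.swap x q) q = x := Equiv.swap_apply_right _ _
    have s3 : ∀ z, z ≠ x → z ≠ q → (Equiv.swap x q) z = z := fun z a b =>
      Equiv.swap_apply_of_ne_of_ne a b
    by_cases hbx : b x = b q
    · have : act (Equiv.swap x q) b = b := by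
        funext z
        simp only [act, Equiv.symm_swap]
        by_cases a : z = x
        · subst a; rw [s1, hbx]
        by_cases a' : z = q
        · subst a'; rw [s2, hbx]
        rw [s3 z a a']
      rw [this]; exact hb
    by_cases hbr : b r = b q
    · have : act (Equiv.swap x q) b = act p b := by
        funext z
        simp only [act, Equiv.symm_swap]
        by_cases a : z = x
        · subst a; rw [s1, e3, hbr]
        by_cases a' : z = q
        · subst a'; rw [s2, e1]
        rw [s3 z a a']
        by_cases a'' : z = r
        · subst a''; rw [e2, hbr]
        rw [e4 z a a' a'']
      rw [this]; exact stab_mem hp hb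
    · have hbr' : b r = b x := by
        revert hbx hbr
        cases b x <;> cases b q <;> cases b r <;> simp
      have : act (Equiv.swap x q) b = act p⁻¹ b := by
        funext z
        change b ((Equiv.swap x q).symm z) = b (p z)
        rw [Equiv.symm_swap]
        by_cases a : z = x
        · subst a; rw [s1, h1]
        by_cases a' : z = q
        · subst a'; rw [s2, h2, hbr']
        rw [s3 z a a']
        by_cases a'' : z = r
        · subst a''; rw [h3, hbr']
        rw [h4 z a a' a'']
      rw [this]; exact stab_mem (stab_inv hp) hb
  change actSet _ C = C
  apply Set.Subset.antisymm
  · rintro _ ⟨b, hb, rfl⟩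
    exact key b hb
  · intro b hb
    refine ⟨_, key b hb, ?_⟩
    rw [← act_mul, Equiv.swap_mul_self]
    rfl

/-- Two stabilising permutations with supports meeting in one point give a transposition. -/
theorem swap_of_two {n : ℕ} {C : Set (Str n)} {g h : Equiv.Perm (Fin n)}
    (hg : g ∈ setStab C) (hh : h ∈ setStab C) {x : Fin n} (hgx : g x ≠ x) (hhx : h x ≠ x)
    (hd : ∀ z, z ≠ x → g z = z ∨ h z = z) : Equiv.swap x (g x) ∈ setStab C := by
  have hgi : ∀ z, g⁻¹ z = z ↔ g z = z := fun z => by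
    rw [Equiv.Perm.inv_eq_iff_eq]; exact eq_comm
  have hhi : ∀ z, h⁻¹ z = z ↔ h z = z := fun z => by
    rw [Equiv.Perm.inv_eq_iff_eq]; exact eq_comm
  have gg : ∀ z, g (g z) = g z ↔ g z = z := fun z => g.injective.eq_iff
  have hhh : ∀ z, h (h z) = h z ↔ h z = z := fun z => h.injective.eq_iff
  have hgf : h (g x) = g x := by
    rcases hd _ hgx with e | e
    · exact absurd ((gg x).1 e) hgx
    · exact e
  have ghf : g (h x) = h x := by
    rcases hd _ hhx with e | e
    · exact e
    · exact absurd ((hhh x).1 e) hhx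
  have A : ∀ z, g (g⁻¹ z) = z := fun z => by simp
  have A2 : ∀ z, g⁻¹ (g z) = z := fun z => by simp
  have B2 : ∀ z, h⁻¹ (h z) = z := fun z => by simp
  have B : ∀ z, h (h⁻¹ z) = z := fun z => by simp
  -- g⁻¹ x is fixed by h, and conversely
  have hgf' : h (g⁻¹ x) = g⁻¹ x := by
    have : g⁻¹ x ≠ x := fun e => hgx ((hgi x).1 e)
    rcases hd _ this with e | e
    · rw [A] at e; exact absurd e.symm this
    · exact e
  have ghf' : g (h⁻¹ x) = h⁻¹ x := by
    have : h⁻¹ x ≠ x := fun e => hhx ((hhi x).1 e)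
    rcases hd _ this with e | e
    · exact e
    · rw [B] at e; exact absurd e.symm this
  have hne : g x ≠ h x := by
    intro e
    rw [← e] at ghf
    exact hgx ((gg x).1 ghf)
  refine swap_of_three (p := g * h * g⁻¹ * h⁻¹) (r := h x)
    (stab_mul (stab_mul (stab_mul hg hh) (stab_inv hg)) (stab_inv hh))
    hgx.symm hhx.symm hne ?_ ?_ ?_ ?_
  · simp only [Equiv.Perm.mul_apply]
    rw [(hgi _).2 ghf', B]
  · simp only [Equiv.Perm.mul_apply]
    rw [(hhi _).2 hgf, A2, ghf]
  · simp only [Equiv.Perm.mul_apply]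
    rw [B2, hgf', A]
  · intro z zx zg zh
    simp only [Equiv.Perm.mul_apply]
    by_cases e : h z = z
    · rw [(hhi _).2 e]
      have : h (g⁻¹ z) = g⁻¹ z := by
        have n1 : g⁻¹ z ≠ x := fun e' => zg (by rw [← e', A])
        rcases hd _ n1 with e' | e'
        · rw [A] at e'; rw [← e']; exact e
        · exact e'
      rw [this, A]
    · have gz : g z = z := (hd z zx).resolve_right e
      have n1 : h⁻¹ z ≠ x := fun e' => zh (by rw [← e', B])
      have : g (h⁻¹ z) = h⁻¹ z := by
        rcases hd _ n1 with e' | e'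
        · exact e'
        · rw [B] at e'; exact absurd ((hhi z).1 e'.symm) e
      rw [(hgi _).2 this, B, gz]

theorem rel_of_swap {n : ℕ} {G : Set (Equiv.Perm (Fin n))} {s : Setoid (Fin n)}
    (hs : IsCoarsestSupp G s) (h1 : (1 : Equiv.Perm (Fin n)) ∈ G) {x y : Fin n}
    (h : Equiv.swap x y ∈ G) : s x y := by
  let f : Fin n → Fin n := fun z => if z = y then x else z
  have hsupp : IsSupporting G (Setoid.ker f) := by
    intro p hp
    have hpf : ∀ z, f (p z) = f z := by
      intro z
      have := hp _ (Setoid.mem_classes (Setoid.ker f) z)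
      have hz : p z ∈ (p : Fin n → Fin n) '' {w | (Setoid.ker f) w z} :=
        ⟨z, (Setoid.ker f).refl z, rfl⟩
      rw [this] at hz
      exact hz
    have hfix : ∀ z, z ≠ x → z ≠ y → p z = z := by
      intro z zx zy
      have := hpf z
      simp only [f, if_neg zy] at this
      split_ifs at this with hh
      · exact absurd this.symm zx
      · exact this
    have hx : p x = x ∨ p x = y := by
      have := hpf x
      simp only [f] at this
      split_ifs at this <;> simp_all
    have hy : p y = x ∨ p y = y := by
      have := hpf y
      simp only [f] at this
      split_ifs at this <;> simp_all
    by_cases hpx : p x = x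
    · have : p = 1 := by
        ext z
        by_cases zx : z = x
        · subst zx; simp [hpx]
        by_cases zy : z = y
        · subst zy
          rcases hy with e | e
          · exact absurd (p.injective (e.trans hpx.symm)) zx
          · simp [e]
        · simp [hfix z zx zy]
      rw [this]; exact h1
    · have hxy : p x = y := hx.resolve_left hpx
      have : p = Equiv.swap x y := by
        ext z
        by_cases zx : z = x
        · subst zx; simp [hxy]
        by_cases zy : z = y
        · subst zy
          rcases hy with e | e
          · simp [e]
          · exact absurd (p.injective (e.trans hxy.symm)) zx
        · simp [hfix z zx zy, Equiv.swap_apply_of_ne_of_ne zx zy]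
      rw [this]; exact h
  obtain ⟨Q, hQ, hPQ⟩ := hs.2 _ hsupp _ (Setoid.mem_classes (Setoid.ker f) x)
  have hxQ : x ∈ Q := hPQ ((Setoid.ker f).refl x)
  have hyQ : y ∈ Q := hPQ (show f y = f x by simp [f])
  obtain ⟨w, rfl⟩ := hQ
  exact s.trans hxQ (s.symm hyQ)

theorem orbit_ge {n : ℕ} (C : Set (Str n)) (L : Finset (Fin n))
    (hL : ∀ p ∈ setStab C, (∀ z, p z ≠ z → z ∈ L) → p = 1) :
    (L.card).factorial ≤ (setOrbit C).ncard := by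
  classical
  let F : Equiv.Perm L → Set (Str n) := fun s => actSet (Equiv.Perm.ofSubtype s) C
  have hF : Function.Injective F := by
    intro s t hst
    have hst' : actSet (Equiv.Perm.ofSubtype s) C = actSet (Equiv.Perm.ofSubtype t) C := hst
    have : Equiv.Perm.ofSubtype (t⁻¹ * s) = 1 := by
      apply hL
      · change actSet _ C = C
        rw [map_mul, actSet_mul, hst', ← actSet_mul, ← map_mul, inv_mul_cancel, map_one,
          actSet_one]
      · intro z hz
        by_contra hzL
        exact hz (Equiv.Perm.ofSubtype_apply_of_not_mem _ hzL)
    have h2 : t⁻¹ * s = 1 := Equiv.Perm.ofSubtype_injective (this.trans (map_one _).symm)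
    exact (inv_mul_eq_one.1 h2).symm
  have h1 : (Set.range F).ncard = L.card.factorial := by
    rw [← Set.image_univ, Set.ncard_image_of_injective _ hF, Set.ncard_univ,
      Nat.card_eq_fintype_card, Fintype.card_perm, Fintype.card_coe]
  rw [← h1]
  apply Set.ncard_le_ncard _ (Set.toFinite _)
  rintro _ ⟨s, rfl⟩
  exact ⟨_, rfl⟩

theorem exists_big {n : ℕ} (C : Set (Str n)) (s : Setoid (Fin n))
    (hs : IsCoarsestSupp (setStab C) s) :
    ∃ m : ℕ, s.classes.ncard ≤ 2 * m ∧ m.factorial ≤ (setOrbit C).ncard := by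
  classical
  let Z : Finset (Fin n) := Finset.univ.image (fun q : Quotient s => q.out)
  have hZc : Z.card = s.classes.ncard := by
    rw [Finset.card_image_of_injective _ Quotient.out_injective, Finset.card_univ,
      ← Nat.card_eq_fintype_card, Nat.card_congr (Setoid.quotientEquivClasses s),
      Nat.card_coe_set_eq]
  have hZ : ∀ x ∈ Z, ∀ y ∈ Z, s x y → x = y := by
    intro x hx y hy hxy
    simp only [Z, Finset.mem_image, Finset.mem_univ, true_and] at hx hy
    obtain ⟨a, rfl⟩ := hx
    obtain ⟨b, rfl⟩ := hy
    rw [Quotient.out_equiv_out.1 hxy]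
  let L := Z.filter fun x => ∀ p ∈ setStab C, (∀ z, p z ≠ z → z ∈ Z ∧ z ≤ x) → p x = x
  let R := Z.filter fun x => ∀ p ∈ setStab C, (∀ z, p z ≠ z → z ∈ Z ∧ x ≤ z) → p x = x
  have hLR : Z ⊆ L ∪ R := by
    intro x hx
    by_contra hcon
    simp only [L, R, Finset.mem_union, Finset.mem_filter, hx, true_and, not_or] at hcon
    obtain ⟨h1, h2⟩ := hcon
    push Not at h1 h2
    obtain ⟨g, hg, hgs, hgx⟩ := h1
    obtain ⟨h, hh, hhs, hhx⟩ := h2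
    have hsw := swap_of_two hg hh hgx hhx (fun z hz => by
      by_contra hcon
      push Not at hcon
      exact hz (le_antisymm (hgs z hcon.1).2 (hhs z hcon.2).2))
    have hr := rel_of_swap hs (actSet_one C) hsw
    have hgZ : g x ∈ Z := (hgs (g x) (fun e => hgx (g.injective e))).1
    exact hgx (hZ x hx _ hgZ hr).symm
  have hcard : Z.card ≤ L.card + R.card :=
    (Finset.card_le_card hLR).trans (Finset.card_union_le _ _)
  have hLo := orbit_ge C L (by
    intro p hp hsup
    by_contra hne
    have hn : p.support.Nonempty := by
      rw [Finset.nonempty_iff_ne_empty]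
      exact fun e => hne (Equiv.Perm.support_eq_empty_iff.1 e)
    have hm := p.support.max'_mem hn
    rw [Equiv.Perm.mem_support] at hm
    exact hm ((Finset.mem_filter.1 (hsup _ hm)).2 p hp fun z hz =>
      ⟨(Finset.mem_filter.1 (hsup z hz)).1,
        p.support.le_max' z (Equiv.Perm.mem_support.2 hz)⟩))
  have hRo := orbit_ge C R (by
    intro p hp hsup
    by_contra hne
    have hn : p.support.Nonempty := by
      rw [Finset.nonempty_iff_ne_empty]
      exact fun e => hne (Equiv.Perm.support_eq_empty_iff.1 e)
    have hm := p.support.min'_mem hn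
    rw [Equiv.Perm.mem_support] at hm
    exact hm ((Finset.mem_filter.1 (hsup _ hm)).2 p hp fun z hz =>
      ⟨(Finset.mem_filter.1 (hsup z hz)).1,
        p.support.min'_le z (Equiv.Perm.mem_support.2 hz)⟩))
  rw [← hZc]
  rcases le_total L.card R.card with hle | hle
  · exact ⟨R.card, by omega, hRo⟩
  · exact ⟨L.card, by omega, hLo⟩

end Aux11

/-- if `B_n ⊆ {0,1}ⁿ` with `|B_n| ≤ c·n` and `|SP(B_n)| ∈ Θ(n)`, then
`|Orbit_n(B_n)|` grows faster than any polynomial in `2ⁿ`. -/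
theorem stmt_11
    (B : ∀ n, Set (Str n))
    (sp : ∀ n, Setoid (Fin n))
    (hsp : ∀ n, IsCoarsestSupp (setStab (B n)) (sp n))
    (c : ℝ) (hc : 0 < c)
    (hB : ∃ N, ∀ n ≥ N, ((B n).ncard : ℝ) ≤ c * n)
    (c₁ c₂ : ℝ) (hc₁ : 0 < c₁) (hc₁₂ : c₁ ≤ c₂)
    (hTheta : ∃ N, ∀ n ≥ N,
      c₁ * n ≤ ((sp n).classes.ncard : ℝ) ∧ ((sp n).classes.ncard : ℝ) ≤ c₂ * n) :
    ∀ (k : ℕ) (C : ℝ), 0 < C → ∃ n, C * (2 : ℝ) ^ (k * n) < ((setOrbit (B n)).ncard : ℝ) := by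
  intro k C hC
  obtain ⟨N, hN⟩ := hTheta
  obtain ⟨d, hd⟩ := exists_nat_gt (2 / c₁)
  have hd0 : (0 : ℝ) < d := lt_trans (by positivity) hd
  have hdN : 1 ≤ d := by exact_mod_cast hd0
  have hlim := FloorSemiring.tendsto_pow_div_factorial_atTop ((2 : ℝ) ^ (k * d))
  have hev := hlim.eventually (gt_mem_nhds (show (0 : ℝ) < 1 / C by positivity))
  obtain ⟨j, hj1, hj2⟩ := (hev.and (Filter.eventually_ge_atTop N)).exists
  refine ⟨d * j, ?_⟩
  have hge : d * j ≥ N := hj2.trans (Nat.le_mul_of_pos_left j hdN)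
  obtain ⟨m, hm1, hm2⟩ := Aux11.exists_big (B (d * j)) (sp (d * j)) (hsp (d * j))
  have h1 := (hN _ hge).1
  have hjm : j ≤ m := by
    have h2 : (((sp (d * j)).classes.ncard : ℕ) : ℝ) ≤ 2 * m := by exact_mod_cast hm1
    rw [div_lt_iff₀ hc₁] at hd
    push_cast at h1
    have h3 : (2 : ℝ) * j ≤ (d * c₁) * j := by gcongr
    have : (j : ℝ) ≤ m := by nlinarith
    exact_mod_cast this
  have hfac : (j.factorial : ℝ) ≤ ((setOrbit (B (d * j))).ncard : ℝ) := by
    exact_mod_cast (Nat.factorial_le hjm).trans hm2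
  refine lt_of_lt_of_le ?_ hfac
  have hpos : (0 : ℝ) < j.factorial := by exact_mod_cast Nat.factorial_pos j
  rw [div_lt_div_iff₀ hpos hC, one_mul] at hj1
  rw [← mul_assoc, pow_mul, mul_comm]
  exact hj1
end

section
/- Let c > 0 be a constant and let (B_n) be a sequence with B_n ⊆ {0,1}^n and |B_n| ≤ c·n for all sufficiently large n. Let S_n = {k ∈ [n] : {k} is a singleton part of SP(B_n)}. Then for all sufficiently large n, |Stab_n(B_n)| ≤ (2cn)^{|S_n|/2} · (n − |S_n|)!. -/
namespace Stab18

lemma act_mul {n : ℕ} (π σ : Equiv.Perm (Fin n)) (v : Str n) :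
    act (π * σ) v = act π (act σ v) := by
  funext i; simp [act, Equiv.Perm.mul_def]

lemma act_one {n : ℕ} (v : Str n) : act (1 : Equiv.Perm (Fin n)) v = v := by
  rfl

/-- the stabiliser as a subgroup -/
def G {n : ℕ} (B : Set (Str n)) : Subgroup (Equiv.Perm (Fin n)) where
  carrier := setStab B
  one_mem' := by
    change act 1 '' B = B
    have : (act (1 : Equiv.Perm (Fin n))) = id := by funext v; exact act_one v
    rw [this, Set.image_id]
  mul_mem' := by
    intro π σ hπ hσ
    change act π '' B = B at hπ
    change act σ '' B = B at hσ
    change act (π * σ) '' B = B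
    have : act (π * σ) = act π ∘ act σ := by funext v; exact act_mul π σ v
    rw [this, Set.image_comp, hσ, hπ]
  inv_mem' := by
    intro π hπ
    change act π '' B = B at hπ
    change act (π⁻¹) '' B = B
    conv_lhs => rw [← hπ]
    rw [← Set.image_comp]
    have : act (π⁻¹) ∘ act π = id := by
      funext v; simp [← act_mul, act_one]
    rw [this, Set.image_id]

lemma mem_G {n : ℕ} {B : Set (Str n)} {π : Equiv.Perm (Fin n)} :
    π ∈ G B ↔ π ∈ setStab B := Iff.rfl

lemma act_mem {n : ℕ} {B : Set (Str n)} {π : Equiv.Perm (Fin n)} (h : π ∈ G B)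
    {b : Str n} (hb : b ∈ B) : act π b ∈ B := by
  have h' : act π '' B = B := h
  rw [← h']; exact ⟨b, hb, rfl⟩

lemma swap_mem {n : ℕ} {B : Set (Str n)} {j k : Fin n}
    (h : ∀ b ∈ B, act (Equiv.swap j k) b ∈ B) : Equiv.swap j k ∈ G B := by
  change act (Equiv.swap j k) '' B = B
  apply Set.Subset.antisymm
  · rintro _ ⟨b, hb, rfl⟩; exact h b hb
  · intro b hb
    refine ⟨_, h b hb, ?_⟩
    rw [← act_mul, Equiv.swap_mul_self, act_one]

/-- members of the stabiliser preserving a colouring -/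
def K {n : ℕ} (B : Set (Str n)) {ι : Type} (f : Fin n → ι) : Set (Equiv.Perm (Fin n)) :=
  {π | π ∈ G B ∧ ∀ x, f (π x) = f x}

lemma K_inv {n : ℕ} {B : Set (Str n)} {ι : Type} {f : Fin n → ι} {π : Equiv.Perm (Fin n)}
    (h : π ∈ K B f) : π⁻¹ ∈ K B f := by
  refine ⟨(G B).inv_mem h.1, fun x => ?_⟩
  have := h.2 (π⁻¹ x)
  simpa using this.symm

lemma K_mul {n : ℕ} {B : Set (Str n)} {ι : Type} {f : Fin n → ι} {π σ : Equiv.Perm (Fin n)}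
    (h : π ∈ K B f) (h' : σ ∈ K B f) : π * σ ∈ K B f := by
  refine ⟨(G B).mul_mem h.1 h'.1, fun x => ?_⟩
  rw [Equiv.Perm.mul_apply, h.2, h'.2]

lemma card_le_aux {P : Type} [Group P] [Finite P] (A A' : Set P) {β : Type} [Finite β]
    (F : A → β) (hF : ∀ π σ : A, F π = F σ → (π : P)⁻¹ * σ ∈ A') :
    A.ncard ≤ Nat.card β * A'.ncard := by
  classical
  have hr : ∀ y : Set.range F, ∃ π : A, F π = y := fun y => y.2
  choose r hr using hr
  rw [← Nat.card_coe_set_eq, ← Nat.card_coe_set_eq, ← Nat.card_prod]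
  let g : A → β × A' := fun π =>
    (F π, ⟨(r ⟨F π, π, rfl⟩ : P)⁻¹ * π, hF _ _ (hr ⟨F π, π, rfl⟩)⟩)
  apply Nat.card_le_card_of_injective g
  intro π σ h
  have h1 : F π = F σ := congrArg Prod.fst h
  have h2 : (r ⟨F π, π, rfl⟩ : P)⁻¹ * π = (r ⟨F σ, σ, rfl⟩ : P)⁻¹ * σ :=
    congrArg (fun z => ((Prod.snd z : A') : P)) h
  have h3 : (⟨F π, π, rfl⟩ : Set.range F) = ⟨F σ, σ, rfl⟩ := Subtype.ext h1
  rw [h3] at h2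
  exact Subtype.ext (mul_left_cancel h2)

/-- size of a colour class -/
def sz {n : ℕ} {ι : Type} [DecidableEq ι] (f : Fin n → ι) (c : ι) : ℕ :=
  (Finset.univ.filter (fun x => f x = c)).card

/-- make one colour class discrete -/
def fixc {n : ℕ} {ι : Type} [DecidableEq ι] (f : Fin n → ι) (c : ι) : Fin n → ι ⊕ Fin n :=
  fun x => if f x = c then Sum.inr x else Sum.inl (f x)

lemma card_fix {n : ℕ} (B : Set (Str n)) {ι : Type} [DecidableEq ι] (f : Fin n → ι) (c : ι) :
    (K B f).ncard ≤ (sz f c).factorial * (K B (fixc f c)).ncard := by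
  have e : Nat.card (Equiv.Perm {x // f x = c}) = (sz f c).factorial := by
    rw [Nat.card_eq_fintype_card, Fintype.card_perm, Fintype.card_subtype]; rfl
  rw [← e]
  apply card_le_aux _ _ (fun π : K B f =>
    (π : Equiv.Perm (Fin n)).subtypePerm (p := fun x => f x = c)
      (fun x => by rw [π.2.2 x]))
  intro π σ h
  have hm := K_mul (K_inv π.2) σ.2
  refine ⟨hm.1, fun x => ?_⟩
  have h1 := hm.2 x
  unfold fixc
  rw [h1]
  split_ifs with hx
  · have h2 := congrArg Subtype.val (Equiv.congr_fun h ⟨x, hx⟩)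
    simp only [Equiv.Perm.subtypePerm_apply] at h2
    congr 1
    rw [Equiv.Perm.mul_apply, ← h2]; simp
  · rfl

/-- refine a colouring by a boolean function -/
def ref {n : ℕ} {ι : Type} (f : Fin n → ι) (g : Fin n → Bool) : Fin n → ι × Bool :=
  fun x => (f x, g x)

lemma card_ref {n : ℕ} (B : Set (Str n)) {ι : Type} (f : Fin n → ι) (b : Str n) (hb : b ∈ B) :
    (K B f).ncard ≤ B.ncard * (K B (ref f b)).ncard := by
  rw [← Nat.card_coe_set_eq B]
  apply card_le_aux _ _ (fun π : K B f =>
    (⟨act π b, act_mem π.2.1 hb⟩ : B))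
  intro π σ h
  have hm := K_mul (K_inv π.2) σ.2
  refine ⟨hm.1, fun x => ?_⟩
  have h2 : act (π : Equiv.Perm (Fin n)) b = act σ b := congrArg Subtype.val h
  have h3 := congrFun h2 ((σ : Equiv.Perm (Fin n)) x)
  simp only [act, Equiv.symm_apply_apply] at h3
  unfold ref
  rw [hm.2 x]
  congr 1

/-- weight -/
noncomputable def w (a : ℝ) (m : ℕ) : ℝ := if m ≤ 1 then 1 else 2 * a ^ (m - 2)

lemma w_pos {a : ℝ} (ha : 2 ≤ a) (m : ℕ) : 0 < w a m := by
  unfold w; split_ifs <;> positivity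

lemma w_zero (a : ℝ) : w a 0 = 1 := by simp [w]
lemma w_one (a : ℝ) : w a 1 = 1 := by simp [w]
lemma w_two (a : ℝ) (m : ℕ) : w a (m + 2) = 2 * a ^ m := by simp [w]

lemma w_big {a : ℝ} (k l : ℕ) (hk : 2 ≤ k) (hl : 2 ≤ l) :
    a ^ 2 / 2 * (w a k * w a l) = w a (k + l) := by
  obtain ⟨k, rfl⟩ := Nat.exists_eq_add_of_le' hk
  obtain ⟨l, rfl⟩ := Nat.exists_eq_add_of_le' hl
  rw [show k + 2 + (l + 2) = (k + l + 2) + 2 by ring, w_two, w_two, w_two]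
  ring

lemma w_split {a : ℝ} (ha : 2 ≤ a) (k l : ℕ) : w a k * w a l ≤ w a (k + l) := by
  have key : ∀ l, w a 1 * w a l ≤ w a (1 + l) := by
    intro l
    rcases l with _ | _ | l
    · simp [w_zero, w_one]
    · simp [w_one]; rw [show (2 : ℕ) = 0 + 2 by rfl, w_two]; norm_num
    · rw [show 1 + (l + 1 + 1) = (l + 1) + 2 by ring, w_one, w_two, w_two, pow_succ]
      have : 0 < a ^ l := by positivity
      nlinarith
  rcases Nat.lt_or_ge k 2 with hk | hk
  · interval_cases k
    · simp [w_zero]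
    · exact key l
  rcases Nat.lt_or_ge l 2 with hl | hl
  · interval_cases l
    · simp [w_zero]
    · rw [mul_comm, add_comm]; exact key k
  rw [← w_big k l hk hl]
  have := mul_pos (w_pos ha k) (w_pos ha l)
  nlinarith [mul_le_mul ha ha (by norm_num) (by linarith)]

lemma w_mid {a : ℝ} (ha : 2 ≤ a) (k l : ℕ) (hk : 1 ≤ k) (hl : 1 ≤ l) (h : 3 ≤ k + l) :
    a * (w a k * w a l) ≤ w a (k + l) := by
  have key : ∀ l, 2 ≤ l → a * (w a 1 * w a l) ≤ w a (1 + l) := by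
    intro l hl
    obtain ⟨l, rfl⟩ := Nat.exists_eq_add_of_le' hl
    rw [show 1 + (l + 2) = (l + 1) + 2 by ring, w_one, w_two, w_two, pow_succ]
    apply le_of_eq; ring
  rcases Nat.lt_or_ge k 2 with hk' | hk'
  · obtain rfl : k = 1 := by omega
    exact key l (by omega)
  rcases Nat.lt_or_ge l 2 with hl' | hl'
  · obtain rfl : l = 1 := by omega
    rw [mul_comm (w a k), add_comm]; exact key k hk'
  rw [← w_big k l hk' hl']
  have := mul_pos (w_pos ha k) (w_pos ha l)
  apply mul_le_mul_of_nonneg_right _ this.le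
  nlinarith

lemma w_fact {a : ℝ} (ha : 2 ≤ a) (m : ℕ) (hm : (m : ℝ) ≤ a) :
    (m.factorial : ℝ) ≤ w a m := by
  rcases m with _ | _ | m
  · simp [w_zero]
  · simp [w_one]
  · rw [show m + 1 + 1 = m + 2 by rfl, w_two]
    induction m with
    | zero => norm_num
    | succ m ih =>
      have h1 := ih (by push_cast at hm ⊢; linarith)
      rw [show m + 1 + 2 = (m + 2) + 1 by ring, Nat.factorial_succ]
      push_cast at hm ⊢
      rw [pow_succ]
      have : (0 : ℝ) < 2 * a ^ m := by positivity
      calc ((m : ℝ) + 2 + 1) * ((m + 2).factorial : ℝ) ≤ a * (2 * a ^ m) := by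
            apply mul_le_mul _ h1 (by positivity) (by linarith)
            linarith
        _ = _ := by ring

lemma w_final {a : ℝ} (ha : 2 ≤ a) (m : ℕ) : w a m ≤ a ^ m := by
  rcases m with _ | _ | m
  · simp [w_zero]
  · simp [w_one]; linarith
  · rw [show m + 1 + 1 = m + 2 by rfl, w_two, pow_add]
    have : (0 : ℝ) < a ^ m := by positivity
    nlinarith [mul_le_mul ha ha (by norm_num) (by linarith)]

/-- total weight -/
noncomputable def W (a : ℝ) {n : ℕ} {ι : Type} [Fintype ι] [DecidableEq ι] (f : Fin n → ι) : ℝ :=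
  ∏ c, w a (sz f c)

/-- number of monochromatic pairs -/
def mu {n : ℕ} {ι : Type} [DecidableEq ι] (f : Fin n → ι) : ℕ :=
  (Finset.univ.filter (fun p : Fin n × Fin n => f p.1 = f p.2)).card

lemma mu_lt {n : ℕ} {ι κ : Type} [DecidableEq ι] [DecidableEq κ] (f : Fin n → ι) (g : Fin n → κ)
    (h : ∀ x y, g x = g y → f x = f y) (j k : Fin n) (h1 : f j = f k) (h2 : g j ≠ g k) :
    mu g < mu f := by
  apply Finset.card_lt_card
  rw [Finset.ssubset_iff_of_subset]
  · exact ⟨(j, k), by simp [h1], by simp [h2]⟩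
  · intro p hp
    simp only [Finset.mem_filter, Finset.mem_univ, true_and] at hp ⊢
    exact h _ _ hp

lemma sz_ref {n : ℕ} {ι : Type} [DecidableEq ι] (f : Fin n → ι) (g : Fin n → Bool) (c : ι) :
    sz (ref f g) (c, true) + sz (ref f g) (c, false) = sz f c := by
  unfold sz ref
  rw [← Finset.card_union_of_disjoint]
  · congr 1
    ext x
    simp only [Finset.mem_union, Finset.mem_filter, Finset.mem_univ, true_and, Prod.mk.injEq]
    cases g x <;> simp
  · rw [Finset.disjoint_left]
    intro x
    simp only [Finset.mem_filter, Finset.mem_univ, true_and, Prod.mk.injEq]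
    rintro ⟨_, h⟩ ⟨_, h'⟩
    simp_all

lemma W_ref {n : ℕ} {ι : Type} [Fintype ι] [DecidableEq ι] (a : ℝ) (f : Fin n → ι)
    (g : Fin n → Bool) :
    W a (ref f g) = ∏ c, (w a (sz (ref f g) (c, true)) * w a (sz (ref f g) (c, false))) := by
  unfold W
  rw [Fintype.prod_prod_type]
  simp

lemma sz_pos {n : ℕ} {ι : Type} [DecidableEq ι] (f : Fin n → ι) (x : Fin n) (c : ι)
    (h : f x = c) : 1 ≤ sz f c := by
  apply Finset.card_pos.mpr
  exact ⟨x, by simp [h]⟩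

lemma W_fix {n : ℕ} {ι : Type} [Fintype ι] [DecidableEq ι] (a : ℝ) (f : Fin n → ι) (c : ι) :
    w a (sz f c) * W a (fixc f c) = W a f := by
  unfold W
  rw [Fintype.prod_sum_type]
  have h2 : ∀ x : Fin n, w a (sz (fixc f c) (Sum.inr x)) = 1 := by
    intro x
    have : sz (fixc f c) (Sum.inr x) ≤ 1 := by
      unfold sz
      apply Finset.card_le_one.mpr
      intro y hy z hz
      rw [Finset.mem_filter] at hy hz
      have hy := hy.2
      have hz := hz.2
      unfold fixc at hy hz
      split_ifs at hy hz
      rw [Sum.inr.inj hy, Sum.inr.inj hz]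
    simp [w, this]
  rw [Finset.prod_congr rfl (fun x _ => h2 x), Finset.prod_const_one, mul_one]
  rw [← Finset.mul_prod_erase Finset.univ (fun d => w a (sz f d)) (Finset.mem_univ c)]
  congr 1
  rw [← Finset.mul_prod_erase Finset.univ _ (Finset.mem_univ c)]
  have h0 : sz (fixc f c) (Sum.inl c) = 0 := by
    unfold sz
    rw [Finset.card_eq_zero, Finset.filter_eq_empty_iff]
    intro x _ hx
    unfold fixc at hx
    split_ifs at hx with h
    exact h (Sum.inl.inj hx)
  rw [h0, w_zero, one_mul]
  apply Finset.prod_congr rfl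
  intro d hd
  have hd : d ≠ c := (Finset.mem_erase.mp hd).1
  congr 1
  unfold sz
  congr 1
  ext x
  rw [Finset.mem_filter, Finset.mem_filter]
  unfold fixc
  split_ifs with h
  · simp [h, hd.symm]
  · simp

lemma W_pos {n : ℕ} {ι : Type} [Fintype ι] [DecidableEq ι] {a : ℝ} (ha : 2 ≤ a) (f : Fin n → ι) :
    0 < W a f := Finset.prod_pos (fun _ _ => w_pos ha _)

lemma W_ref_le {n : ℕ} {ι : Type} [Fintype ι] [DecidableEq ι] {a : ℝ} (ha : 2 ≤ a)
    (f : Fin n → ι) (g : Fin n → Bool) : W a (ref f g) ≤ W a f := by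
  rw [W_ref]
  apply Finset.prod_le_prod
  · intro c _; exact (mul_pos (w_pos ha _) (w_pos ha _)).le
  · intro c _; rw [← sz_ref f g c]; exact w_split ha _ _

/-- one class split into two classes of size at least two -/
lemma W_ref_one {n : ℕ} {ι : Type} [Fintype ι] [DecidableEq ι] {a : ℝ} (ha : 2 ≤ a)
    (f : Fin n → ι) (g : Fin n → Bool) (c : ι) (h1 : 2 ≤ sz (ref f g) (c, true))
    (h2 : 2 ≤ sz (ref f g) (c, false)) : a ^ 2 / 2 * W a (ref f g) ≤ W a f := by
  rw [W_ref]
  unfold W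
  rw [← Finset.mul_prod_erase Finset.univ _ (Finset.mem_univ c),
    ← Finset.mul_prod_erase Finset.univ (fun d => w a (sz f d)) (Finset.mem_univ c), ← mul_assoc]
  apply mul_le_mul
  · rw [w_big _ _ h1 h2, sz_ref]
  · apply Finset.prod_le_prod
    · intro c _; exact (mul_pos (w_pos ha _) (w_pos ha _)).le
    · intro c _; rw [← sz_ref f g c]; exact w_split ha _ _
  · exact Finset.prod_nonneg (fun _ _ => (mul_pos (w_pos ha _) (w_pos ha _)).le)
  · exact (w_pos ha _).le

/-- two classes of size at least three are split -/
lemma W_ref_two {n : ℕ} {ι : Type} [Fintype ι] [DecidableEq ι] {a : ℝ} (ha : 2 ≤ a)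
    (f : Fin n → ι) (g : Fin n → Bool) (c d : ι) (hcd : d ≠ c)
    (h1 : 1 ≤ sz (ref f g) (c, true)) (h2 : 1 ≤ sz (ref f g) (c, false)) (h3 : 3 ≤ sz f c)
    (h1' : 1 ≤ sz (ref f g) (d, true)) (h2' : 1 ≤ sz (ref f g) (d, false)) (h3' : 3 ≤ sz f d) :
    a ^ 2 / 2 * W a (ref f g) ≤ W a f := by
  have hW := W_pos ha (ref f g)
  have : a ^ 2 * W a (ref f g) ≤ W a f := by
    rw [W_ref]
    unfold W
    have hd : d ∈ Finset.univ.erase c := by simp [hcd]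
    rw [← Finset.mul_prod_erase Finset.univ _ (Finset.mem_univ c),
      ← Finset.mul_prod_erase Finset.univ (fun d => w a (sz f d)) (Finset.mem_univ c),
      ← Finset.mul_prod_erase _ _ hd,
      ← Finset.mul_prod_erase _ (fun d => w a (sz f d)) hd, pow_two, mul_mul_mul_comm, ← mul_assoc a (_ * _) (∏ x ∈ _, _)]
    apply mul_le_mul
    · have := w_mid ha _ _ h1 h2 (by rw [sz_ref]; exact h3)
      rwa [sz_ref] at this
    · apply mul_le_mul
      · have := w_mid ha _ _ h1' h2' (by rw [sz_ref]; exact h3')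
        rwa [sz_ref] at this
      · apply Finset.prod_le_prod
        · intro c _; exact (mul_pos (w_pos ha _) (w_pos ha _)).le
        · intro c _; rw [← sz_ref f g c]; exact w_split ha _ _
      · exact Finset.prod_nonneg (fun _ _ => (mul_pos (w_pos ha _) (w_pos ha _)).le)
      · exact (w_pos ha _).le
    · have := w_pos ha (sz (ref f g) (d, true))
      have := w_pos ha (sz (ref f g) (d, false))
      have : 0 ≤ ∏ x ∈ (Finset.univ.erase c).erase d,
        (w a (sz (ref f g) (x, true)) * w a (sz (ref f g) (x, false))) :=
        Finset.prod_nonneg (fun _ _ => (mul_pos (w_pos ha _) (w_pos ha _)).le)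
      positivity
    · exact (w_pos ha _).le
  nlinarith [mul_pos (pow_pos (by linarith : 0 < a) 2) hW]

/-- the stuck case: a free refinement exists -/
lemma free {n : ℕ} (B : Set (Str n)) {ι : Type} [DecidableEq ι] (f : Fin n → ι)
    (b : Str n) (hb : b ∈ B) (j k : Fin n) (hjk : f j = f k)
    (hj : ∀ y, f y = f j → y ≠ j → b y ≠ b j)
    (hconst : ∀ x y, f x = f y → f x ≠ f j → b x = b y)
    (hn : act (Equiv.swap j k) b ∉ B) :
    ∃ g : Fin n → Bool, g j ≠ g k ∧ K B f ⊆ K B (ref f g) := by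
  classical
  let J : Set (Fin n) := {y | f y = f j ∧ act (Equiv.swap j y) b ∈ B}
  have hJ : ∀ π ∈ K B f, ∀ y ∈ J, π y ∈ J := by
    intro π hπ y hy
    refine ⟨by rw [hπ.2, hy.1], ?_⟩
    have := act_mem hπ.1 hy.2
    convert this using 1
    funext z
    have hz : f (π.symm z) = f z := by
      have := hπ.2 (π.symm z); simpa using this.symm
    simp only [act, Equiv.symm_swap]
    by_cases hzj : f z = f j
    · -- in the class
      have key : ∀ u v, f u = f j → f v = f j → (b (Equiv.swap j u v) = b j ↔ v = u) := by
        intro u v hu hv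
        by_cases h : v = u
        · subst h; simp
        · simp only [h, iff_false]
          apply hj
          · by_cases h' : v = j
            · subst h'; rw [Equiv.swap_apply_left]; exact hu
            · rw [Equiv.swap_apply_of_ne_of_ne h' h]; exact hv
          · intro h'
            apply h
            rw [Equiv.swap_apply_eq_iff, Equiv.swap_apply_left] at h'
            exact h'
      have k1 := key (π y) z (by rw [hπ.2, hy.1]) hzj
      have k2 := key y (π.symm z) hy.1 (by rw [hz, hzj])
      have k3 : z = π y ↔ π.symm z = y := by rw [Equiv.symm_apply_eq]
      have k4 := k1.trans (k3.trans k2.symm)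
      have aux : ∀ p q r : Bool, (p = r ↔ q = r) → p = q := by
        intro p q r
        cases p <;> cases q <;> cases r <;> simp
      exact aux _ _ _ k4
    · have e : ∀ u v, f u = f j → f v ≠ f j → Equiv.swap j u v = v := by
        intro u v hu hv
        apply Equiv.swap_apply_of_ne_of_ne
        · rintro rfl; exact hv rfl
        · rintro rfl; exact hv hu
      rw [e _ _ (by rw [hπ.2, hy.1]) hzj, e _ _ hy.1 (by rwa [hz])]
      exact hconst _ _ hz.symm hzj
  have hjJ : j ∈ J := ⟨rfl, by
    rw [Equiv.swap_self]; change act 1 b ∈ B; rw [act_one]; exact hb⟩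
  have hkJ : k ∉ J := fun h => hn h.2
  refine ⟨fun x => decide (x ∈ J), by simp [hjJ, hkJ], ?_⟩
  intro π hπ
  refine ⟨hπ.1, fun x => ?_⟩
  unfold ref
  rw [hπ.2 x]
  congr 1
  rw [decide_eq_decide]
  constructor
  · intro h
    have := hJ _ (K_inv hπ) _ h
    simpa using this
  · exact hJ π hπ x

lemma sz_ge_two {n : ℕ} {ι : Type} [DecidableEq ι] (f : Fin n → ι) (c : ι) (x y : Fin n)
    (hx : f x = c) (hy : f y = c) (h : x ≠ y) : 2 ≤ sz f c := by
  apply Finset.one_lt_card.mpr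
  exact ⟨x, by simp [hx], y, by simp [hy], h⟩

lemma main {n : ℕ} (B : Set (Str n)) {a : ℝ} (ha : 2 ≤ a) (hB : (B.ncard : ℝ) ≤ a ^ 2 / 2)
    (N : ℕ) : ∀ {ι : Type} [Fintype ι] [DecidableEq ι] (f : Fin n → ι), mu f < N →
    (∀ j k, j ≠ k → f j = f k → Equiv.swap j k ∉ G B) → ((K B f).ncard : ℝ) ≤ W a f := by
  induction N with
  | zero => intro ι _ _ f h; omega
  | succ N ih =>
  intro ι _ _ f hmu hsw
  -- step: paying for a string
  have stepb : ∀ b ∈ B, (∃ j k, f j = f k ∧ b j ≠ b k) →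
      a ^ 2 / 2 * W a (ref f b) ≤ W a f → ((K B f).ncard : ℝ) ≤ W a f := by
    rintro b hb ⟨j, k, hjk, hbjk⟩ hW
    have h1 : ((K B f).ncard : ℝ) ≤ (B.ncard : ℝ) * ((K B (ref f b)).ncard : ℝ) := by
      exact_mod_cast card_ref B f b hb
    have h2 := ih (ref f b) (lt_of_lt_of_le (mu_lt f (ref f b)
      (fun x y h => congrArg Prod.fst h) j k hjk
      (fun h => hbjk (congrArg Prod.snd h))) (Nat.lt_succ_iff.mp hmu))
      (fun j k h h' => hsw j k h (congrArg Prod.fst h'))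
    refine h1.trans (le_trans ?_ hW)
    exact mul_le_mul hB h2 (by positivity) (by positivity)
  by_cases hinj : ∀ j k, f j = f k → j = k
  · have : (K B f).ncard ≤ 1 := by
      rw [Set.ncard_le_one]
      intro π hπ σ hσ
      ext x
      rw [hinj _ _ ((hπ.2 x).trans (hσ.2 x).symm)]
    have h1 : (1 : ℝ) ≤ W a f := by
      unfold W
      rw [Finset.prod_eq_one]
      intro c _
      have : sz f c ≤ 1 := by
        apply Finset.card_le_one.mpr
        intro x hx y hy
        simp only [Finset.mem_filter, Finset.mem_univ, true_and] at hx hy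
        exact hinj _ _ (hx.trans hy.symm)
      simp [w, this]
    refine le_trans ?_ h1
    exact_mod_cast this
  push Not at hinj
  -- small cells
  by_cases hsmall : ∃ j k, f j = f k ∧ j ≠ k ∧ (sz f (f j) : ℝ) ≤ a
  · obtain ⟨j, k, hjk, hne, hs⟩ := hsmall
    have h1 : ((K B f).ncard : ℝ) ≤
        ((sz f (f j)).factorial : ℝ) * ((K B (fixc f (f j))).ncard : ℝ) := by
      exact_mod_cast card_fix B f (f j)
    have hcoarse : ∀ x y, fixc f (f j) x = fixc f (f j) y → f x = f y := by
      intro x y h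
      unfold fixc at h
      split_ifs at h
      · rw [Sum.inr.inj h]
      · exact Sum.inl.inj h
    have h2 := ih (fixc f (f j)) (lt_of_lt_of_le (mu_lt f (fixc f (f j)) hcoarse j k hjk
      (by simp [fixc, hjk, hne])) (Nat.lt_succ_iff.mp hmu))
      (fun j k h h' => hsw j k h (hcoarse _ _ h'))
    rw [← W_fix a f (f j)]
    exact h1.trans (mul_le_mul (w_fact ha _ hs) h2 (by positivity) (w_pos ha _).le)
  push Not at hsmall
  have hbig : ∀ j k, f j = f k → j ≠ k → 3 ≤ sz f (f j) := by
    intro j k h h'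
    have := hsmall j k h h'
    have : (2 : ℝ) < (sz f (f j) : ℝ) := by linarith
    exact_mod_cast this
  have hpos : ∀ (b : Str n) j k, f j = f k → b j ≠ b k →
      1 ≤ sz (ref f b) (f j, true) ∧ 1 ≤ sz (ref f b) (f j, false) := by
    intro b j k h h'
    cases hbj : b j <;> cases hbk : b k <;> simp only [hbj, hbk, ne_eq, not_true_eq_false] at h'
    · exact ⟨sz_pos _ k _ (by simp [ref, h, hbk]), sz_pos _ j _ (by simp [ref, hbj])⟩
    · exact ⟨sz_pos _ j _ (by simp [ref, hbj]), sz_pos _ k _ (by simp [ref, h, hbk])⟩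
  by_cases hA : ∃ b ∈ B, ∃ j k, f j = f k ∧ b j ≠ b k ∧ 2 ≤ sz (ref f b) (f j, true) ∧
      2 ≤ sz (ref f b) (f j, false)
  · obtain ⟨b, hb, j, k, h1, h2, h3, h4⟩ := hA
    exact stepb b hb ⟨j, k, h1, h2⟩ (W_ref_one ha f b _ h3 h4)
  by_cases hC : ∃ b ∈ B, ∃ j k x y, f j = f k ∧ b j ≠ b k ∧ f x = f y ∧ b x ≠ b y ∧ f x ≠ f j
  · obtain ⟨b, hb, j, k, x, y, h1, h2, h3, h4, h5⟩ := hC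
    refine stepb b hb ⟨j, k, h1, h2⟩ (W_ref_two ha f b (f j) (f x) h5
      (hpos b j k h1 h2).1 (hpos b j k h1 h2).2 (hbig j k h1 (fun h => h2 (by rw [h])))
      (hpos b x y h3 h4).1 (hpos b x y h3 h4).2 (hbig x y h3 (fun h => h4 (by rw [h]))))
  -- stuck
  obtain ⟨j, k, hjk, hne⟩ := hinj
  have hnot : ¬ ∀ b ∈ B, act (Equiv.swap j k) b ∈ B := fun h => hsw j k hne hjk (swap_mem h)
  push Not at hnot
  obtain ⟨b, hb, hnb⟩ := hnot
  have hbjk : b j ≠ b k := by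
    intro h
    apply hnb
    have : act (Equiv.swap j k) b = b := by
      funext z
      simp only [act, Equiv.symm_swap]
      by_cases hz : z = j
      · subst hz; simp [h]
      by_cases hz' : z = k
      · subst hz'; simp [h]
      rw [Equiv.swap_apply_of_ne_of_ne hz hz']
    rwa [this]
  have hconst : ∀ x y, f x = f y → f x ≠ f j → b x = b y := by
    intro x y h h'
    by_contra hxy
    exact hC ⟨b, hb, j, k, x, y, hjk, hbjk, h, hxy, h'⟩
  have hodd : (∀ y, f y = f j → y ≠ j → b y ≠ b j) ∨ (∀ y, f y = f k → y ≠ k → b y ≠ b k) := by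
    by_contra hcon
    push Not at hcon
    obtain ⟨⟨y, hy, hyj, hby⟩, z, hz, hzk, hbz⟩ := hcon
    apply hA
    refine ⟨b, hb, j, k, hjk, hbjk, ?_⟩
    cases hbj : b j <;> cases hbk : b k <;> simp only [hbj, hbk, ne_eq, not_true_eq_false] at hbjk
    · exact ⟨sz_ge_two _ _ z k (by simp [ref, hz, hjk, hbz, hbk]) (by simp [ref, hjk, hbk]) hzk,
        sz_ge_two _ _ y j (by simp [ref, hy, hby, hbj]) (by simp [ref, hbj]) hyj⟩
    · exact ⟨sz_ge_two _ _ y j (by simp [ref, hy, hby, hbj]) (by simp [ref, hbj]) hyj,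
        sz_ge_two _ _ z k (by simp [ref, hz, hjk, hbz, hbk]) (by simp [ref, hjk, hbk]) hzk⟩
  have hg : ∃ g : Fin n → Bool, g j ≠ g k ∧ K B f ⊆ K B (ref f g) := by
    rcases hodd with h | h
    · exact free B f b hb j k hjk h hconst hnb
    · obtain ⟨g, h1, h2⟩ := free B f b hb k j hjk.symm h (by rwa [← hjk])
        (by rwa [Equiv.swap_comm])
      exact ⟨g, h1.symm, h2⟩
  obtain ⟨g, hgjk, hK⟩ := hg
  have h2 := ih (ref f g) (lt_of_lt_of_le (mu_lt f (ref f g)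
      (fun x y h => congrArg Prod.fst h) j k hjk
      (fun h => hgjk (congrArg Prod.snd h))) (Nat.lt_succ_iff.mp hmu))
      (fun j k h h' => hsw j k h (congrArg Prod.fst h'))
  have h1 : ((K B f).ncard : ℝ) ≤ ((K B (ref f g)).ncard : ℝ) := by
    exact_mod_cast Set.ncard_le_ncard hK (Set.toFinite _)
  exact h1.trans (h2.trans (W_ref_le ha f g))

/-- the equivalence relation merging `j` and `k` -/
def pairSetoid {n : ℕ} (j k : Fin n) : Setoid (Fin n) where
  r x y := x = y ∨ ((x = j ∨ x = k) ∧ (y = j ∨ y = k))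
  iseqv := ⟨fun _ => Or.inl rfl, by intro x y h; tauto, by
    intro x y z h h'
    rcases h with rfl | h
    · exact h'
    · rcases h' with rfl | h'
      · exact Or.inr h
      · exact Or.inr ⟨h.1, h'.2⟩⟩

lemma ptStab_rel {n : ℕ} (s : Setoid (Fin n)) (π : Equiv.Perm (Fin n)) :
    π ∈ ptStab s ↔ ∀ x, s (π x) x := by
  constructor
  · intro h x
    have h1 := h {y | s y x} (Setoid.mem_classes s x)
    have : π x ∈ π '' {y | s y x} := ⟨x, s.refl x, rfl⟩
    rw [h1] at this
    exact this
  · rintro h P ⟨y, rfl⟩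
    ext x
    constructor
    · rintro ⟨z, hz, rfl⟩
      exact s.trans (h z) hz
    · intro hx
      refine ⟨π.symm x, ?_, by simp⟩
      have := h (π.symm x)
      rw [Equiv.apply_symm_apply] at this
      exact s.trans (s.symm this) hx

lemma singleton_iff {n : ℕ} (B : Set (Str n)) (s : Setoid (Fin n))
    (hs : IsCoarsestSupp (setStab B) s) (k : Fin n) :
    {k} ∈ s.classes ↔ ∀ j, j ≠ k → Equiv.swap j k ∉ G B := by
  constructor
  · intro hk j hjk hsw
    have hsup : IsSupporting (setStab B) (pairSetoid j k) := by
      intro π hπ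
      rw [ptStab_rel] at hπ
      have hπ' : ∀ x, π x = x ∨ ((π x = j ∨ π x = k) ∧ (x = j ∨ x = k)) := hπ
      have hfix : ∀ x, x ≠ j → x ≠ k → π x = x := by
        intro x h1 h2
        rcases hπ' x with h | h
        · exact h
        · tauto
      by_cases hj : π j = j
      · have : π = 1 := by
          apply Equiv.ext
          intro x
          by_cases h1 : x = j
          · rw [h1, hj]; rfl
          by_cases h2 : x = k
          · subst h2
            rcases hπ' x with h | ⟨h | h, _⟩
            · exact h
            · exact absurd (π.injective (h.trans hj.symm)) h1
            · exact h
          exact hfix x h1 h2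
        rw [this]; exact (G B).one_mem
      · have hj' : π j = k := by
          rcases hπ' j with h | ⟨h | h, _⟩
          · exact absurd h hj
          · exact absurd h hj
          · exact h
        have hk' : π k = j := by
          rcases hπ' k with h | ⟨h | h, _⟩
          · exact absurd (π.injective (hj'.trans h.symm)) hjk
          · exact h
          · exact absurd (π.injective (hj'.trans h.symm)) hjk
        have : π = Equiv.swap j k := by
          apply Equiv.ext
          intro x
          by_cases h1 : x = j
          · rw [h1, hj', Equiv.swap_apply_left]
          by_cases h2 : x = k
          · rw [h2, hk', Equiv.swap_apply_right]
          rw [hfix x h1 h2, Equiv.swap_apply_of_ne_of_ne h1 h2]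
        rw [this]; exact hsw
    obtain ⟨Q, hQ, hsub⟩ := hs.2 _ hsup _ (Setoid.mem_classes (pairSetoid j k) k)
    have hkQ : k ∈ Q := hsub (show pairSetoid j k k k from (pairSetoid j k).refl k)
    have hjQ : j ∈ Q := hsub (show pairSetoid j k j k from Or.inr ⟨Or.inl rfl, Or.inr rfl⟩)
    have : Q = {k} := Setoid.eq_of_mem_classes hQ hkQ hk rfl
    rw [this] at hjQ
    exact hjk hjQ
  · intro h
    refine ⟨k, ?_⟩
    ext j
    constructor
    · rintro rfl; exact s.refl j
    · intro hj
      by_contra hne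
      apply h j hne
      apply hs.1
      rw [ptStab_rel]
      intro x
      by_cases h1 : x = j
      · subst h1; rw [Equiv.swap_apply_left]; exact s.symm hj
      by_cases h2 : x = k
      · subst h2; rw [Equiv.swap_apply_right]; exact hj
      rw [Equiv.swap_apply_of_ne_of_ne h1 h2]

lemma perm_singleton {n : ℕ} (B : Set (Str n)) (s : Setoid (Fin n))
    (hs : IsCoarsestSupp (setStab B) s) (k : Fin n) (π : Equiv.Perm (Fin n)) (hπ : π ∈ G B)
    (hk : {k} ∈ s.classes) : {π k} ∈ s.classes := by
  rw [singleton_iff B s hs] at hk ⊢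
  intro j hj hsw
  apply hk (π⁻¹ j)
  · rintro rfl; simp at hj
  · have : Equiv.swap (π⁻¹ j) k = π⁻¹ * Equiv.swap j (π k) * π := by
      rw [mul_assoc, Equiv.swap_mul_eq_mul_swap]
      simp
    rw [this]
    exact (G B).mul_mem ((G B).mul_mem ((G B).inv_mem hπ) hsw) hπ

lemma fixed_n {n : ℕ} (B : Set (Str n)) (s : Setoid (Fin n))
    (hs : IsCoarsestSupp (setStab B) s) {a : ℝ} (ha : 2 ≤ a) (hB : (B.ncard : ℝ) ≤ a ^ 2 / 2) :
    ((setStab B).ncard : ℝ) ≤ a ^ ({k : Fin n | {k} ∈ s.classes}).ncard *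
      Nat.factorial (n - ({k : Fin n | {k} ∈ s.classes}).ncard) := by
  classical
  set S := {k : Fin n | {k} ∈ s.classes} with hS
  let f : Fin n → Bool := fun x => decide (x ∈ S)
  have hK : setStab B = K B f := by
    ext π
    constructor
    · intro hπ
      refine ⟨hπ, fun x => ?_⟩
      simp only [f, decide_eq_decide]
      constructor
      · intro h
        have := perm_singleton B s hs (π x) π⁻¹ ((G B).inv_mem hπ) h
        have e : π⁻¹ (π x) = x := by simp
        rw [e] at this
        exact this
      · exact perm_singleton B s hs x π hπ
    · exact fun h => h.1
  have hszt : sz f true = S.ncard := by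
    rw [Set.ncard_eq_toFinset_card']
    unfold sz
    congr 1
    ext x
    simp [f]
  have hszf : sz f false = n - S.ncard := by
    have h1 := Finset.card_filter_add_card_filter_not (s := (Finset.univ : Finset (Fin n)))
      (fun x => f x = true)
    have h2 : sz f true + sz f false = n := by
      simpa [sz] using h1
    omega
  have h1 : ((K B f).ncard : ℝ) ≤
      ((sz f false).factorial : ℝ) * ((K B (fixc f false)).ncard : ℝ) := by
    exact_mod_cast card_fix B f false
  have h2 := main B ha hB _ (fixc f false) (Nat.lt_succ_self _) (by
    intro j k hjk hf
    unfold fixc at hf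
    split_ifs at hf with h1 h2 h2
    · exact absurd (Sum.inr.inj hf) hjk
    · have : k ∈ S := by simpa [f] using h2
      exact (singleton_iff B s hs k).mp this j hjk)
  have h3 : W a (fixc f false) = w a S.ncard := by
    have := W_fix a f false
    have hW : W a f = w a (sz f true) * w a (sz f false) := by
      unfold W; simp
    rw [hW, mul_comm] at this
    rw [← hszt]
    exact mul_right_cancel₀ (w_pos ha _).ne' this
  rw [hK, mul_comm, ← hszf]
  refine h1.trans (mul_le_mul_of_nonneg_left ?_ (by positivity))
  rw [h3] at h2
  exact h2.trans (w_final ha _)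

end Stab18

/-- if `|B_n| ≤ c·n` for sufficiently large `n`, and `S_n` is the set
of positions in singleton parts of `SP(B_n)`, then for all sufficiently large `n`,
`|Stab_n(B_n)| ≤ (2cn)^{|S_n|/2} · (n − |S_n|)!` (the exponent is a real number,
via the real power function). -/
theorem stmt_18 (c : ℝ) (hc : 0 < c)
    (B : ∀ n, Set (Str n))
    (hB : ∃ N, ∀ n ≥ N, ((B n).ncard : ℝ) ≤ c * n)
    (sp : ∀ n, Setoid (Fin n))
    (hsp : ∀ n, IsCoarsestSupp (setStab (B n)) (sp n)) :
    ∃ N, ∀ n ≥ N,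
      ((setStab (B n)).ncard : ℝ) ≤
        (2 * c * n) ^ (((({k : Fin n | {k} ∈ (sp n).classes}).ncard : ℝ)) / 2)
          * Nat.factorial (n - ({k : Fin n | {k} ∈ (sp n).classes}).ncard) := by
  obtain ⟨N, hN⟩ := hB
  refine ⟨max N (Nat.ceil (2 / c)), fun n hn => ?_⟩
  have h1 := hN n (le_trans (le_max_left _ _) hn)
  have h2 : 2 / c ≤ n := (Nat.le_ceil _).trans (by exact_mod_cast le_trans (le_max_right _ _) hn)
  have h3 : 2 ≤ c * n := by
    rw [div_le_iff₀ hc] at h2; linarith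
  have hnn : 0 ≤ 2 * c * n := by nlinarith
  have hsq : Real.sqrt (2 * c * n) ^ 2 = 2 * c * n := Real.sq_sqrt hnn
  have ha : 2 ≤ Real.sqrt (2 * c * n) := by
    apply Real.le_sqrt_of_sq_le; nlinarith
  have := Stab18.fixed_n (B n) (sp n) (hsp n) ha (by rw [hsq]; linarith)
  rw [Real.sqrt_eq_rpow, ← Real.rpow_natCast, ← Real.rpow_mul hnn] at this
  convert this using 3
  ring
end

section
/- Let c > 0 and δ > 0 be constants and let (B_n) be a sequence with B_n ⊆ {0,1}^n such that, for all sufficiently large n, |B_n| ≤ c·n and |S_n| ≥ δ·n, where S_n = {k ∈ [n] : {k} is a singleton part of SP(B_n)}. Then |Orbit_n(B_n)| grows faster than any polynomial in 2^n; precisely, for every k ∈ ℕ and every real C > 0 there exists n with |Orbit_n(B_n)| > C · 2^{k·n}. -/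
theorem aux_act_mul {n : ℕ} (g h : Equiv.Perm (Fin n)) (v : Str n) :
    act (g * h) v = act g (act h v) := by
  funext i; simp [act, Equiv.Perm.mul_def]

theorem aux_act_one {n : ℕ} (v : Str n) : act (1 : Equiv.Perm (Fin n)) v = v := by
  rfl

theorem aux_actSet_mul {n : ℕ} (g h : Equiv.Perm (Fin n)) (C : Set (Str n)) :
    actSet (g * h) C = actSet g (actSet h C) := by
  unfold actSet
  rw [Set.image_image]
  exact Set.image_congr fun v _ => aux_act_mul g h v

theorem aux_actSet_one {n : ℕ} (C : Set (Str n)) :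
    actSet (1 : Equiv.Perm (Fin n)) C = C := by
  unfold actSet
  simp [aux_act_one]

theorem aux_one_mem {n : ℕ} (C : Set (Str n)) : 1 ∈ setStab C := aux_actSet_one C

theorem aux_mul_mem {n : ℕ} {C : Set (Str n)} {g h : Equiv.Perm (Fin n)}
    (hg : g ∈ setStab C) (hh : h ∈ setStab C) : g * h ∈ setStab C := by
  simp only [setStab, Set.mem_ofPred_eq] at *
  rw [aux_actSet_mul, hh, hg]

theorem aux_inv_mem {n : ℕ} {C : Set (Str n)} {g : Equiv.Perm (Fin n)}
    (hg : g ∈ setStab C) : g⁻¹ ∈ setStab C := by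
  simp only [setStab, Set.mem_ofPred_eq] at *
  conv_lhs => rw [← hg]
  rw [← aux_actSet_mul]
  simp [aux_actSet_one]

theorem aux_mem {n : ℕ} {C : Set (Str n)} {g : Equiv.Perm (Fin n)}
    (hg : g ∈ setStab C) {v : Str n} (hv : v ∈ C) : act g v ∈ C := by
  have : actSet g C = C := hg
  rw [← this]
  exact ⟨v, hv, rfl⟩

/-- A 3-cycle in the stabiliser gives a transposition in the stabiliser. -/
theorem aux_swap_mem {n : ℕ} {C : Set (Str n)} {a b c : Fin n}
    (hab : a ≠ b) (hbc : b ≠ c) (hac : a ≠ c)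
    (hg : Equiv.swap a b * Equiv.swap b c ∈ setStab C) : Equiv.swap a b ∈ setStab C := by
  have key : ∀ v ∈ C, act (Equiv.swap a b) v ∈ C := by
    intro v hv
    have h1 := aux_mem hg hv
    have h2 := aux_mem (aux_inv_mem hg) hv
    have cases3 : v a = v b ∨ v b = v c ∨ v a = v c := by
      cases v a <;> cases v b <;> cases v c <;> simp
    rcases cases3 with h | h | h
    · have : act (Equiv.swap a b) v = v := by
        funext i
        simp only [act, Equiv.symm_swap, Equiv.swap_apply_def]
        split_ifs <;> simp_all
      rwa [this]
    · have : act (Equiv.swap a b) v = act (Equiv.swap a b * Equiv.swap b c) v := by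
        funext i
        rw [aux_act_mul]
        simp only [act, Equiv.symm_swap, Equiv.swap_apply_def]
        split_ifs <;> simp_all
      rwa [this]
    · have : act (Equiv.swap a b) v = act (Equiv.swap a b * Equiv.swap b c)⁻¹ v := by
        funext i
        rw [mul_inv_rev, aux_act_mul]
        simp only [act, Equiv.swap_inv, Equiv.symm_swap, Equiv.swap_apply_def]
        split_ifs <;> simp_all
      rwa [this]
  apply Set.Subset.antisymm
  · rintro _ ⟨v, hv, rfl⟩
    exact key v hv
  · intro v hv
    refine ⟨_, key v hv, ?_⟩
    rw [← aux_act_mul]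
    simp [aux_act_one]

theorem aux_commutator {n : ℕ} (g h : Equiv.Perm (Fin n)) (a : Fin n)
    (hga : g a ≠ a) (hha : h a ≠ a) (hd : ∀ x, x ≠ a → g x = x ∨ h x = x) :
    g * h * g⁻¹ * h⁻¹ = Equiv.swap a (g a) * Equiv.swap (g a) (h a) ∧ g a ≠ h a := by
  have hgb : h (g a) = g a := by
    rcases hd _ hga with h1 | h1
    · exact absurd (g.injective h1) hga
    · exact h1
  have hhc : g (h a) = h a := by
    rcases hd _ hha with h1 | h1
    · exact h1
    · exact absurd (h.injective h1) hha
  have hne : g a ≠ h a := by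
    intro e
    rw [← e] at hhc
    exact hga (g.injective hhc)
  refine ⟨?_, hne⟩
  rw [mul_inv_eq_iff_eq_mul, mul_inv_eq_iff_eq_mul]
  ext1 x
  simp only [Equiv.Perm.mul_apply]
  by_cases hx : x = a
  · subst hx
    simp [hhc, hgb, Equiv.swap_apply_def, hne, hga, hha, hne.symm]
  · have e1 : g x ≠ g a := fun e => hx (g.injective e)
    have e2 : h x ≠ h a := fun e => hx (h.injective e)
    rcases hd x hx with h1 | h1
    · rw [h1]
      by_cases hxa : h x = a
      · rw [hxa]
        rw [Equiv.swap_apply_of_ne_of_ne hga.symm hha.symm, Equiv.swap_apply_left]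
      · have e3 : h x ≠ g a := by
          intro e
          rw [← hgb] at e
          exact e1 (h1.trans (h.injective e))
        rw [Equiv.swap_apply_of_ne_of_ne e3 e2, Equiv.swap_apply_of_ne_of_ne hxa e3]
        rcases hd (h x) hxa with h2 | h2
        · exact h2
        · rw [h.injective h2, h1]
    · rw [h1]
      have hxc : x ≠ h a := fun e => e2 (h1.trans e)
      by_cases hxa : g x = a
      · rw [hxa, Equiv.swap_apply_right, Equiv.swap_apply_right]
      · have e3 : g x ≠ h a := by
          intro e
          rw [← hhc] at e
          exact hxc (g.injective e)
        have e4 : h (g x) = g x := by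
          rcases hd (g x) hxa with h2 | h2
          · rw [g.injective h2, h1]
          · exact h2
        rw [e4, Equiv.swap_apply_of_ne_of_ne e1 e3, Equiv.swap_apply_of_ne_of_ne hxa e1]

/-- A transposition in the group never moves a singleton part of the coarsest
supporting partition. -/
theorem aux_no_swap {n : ℕ} {G : Set (Equiv.Perm (Fin n))} {s : Setoid (Fin n)}
    (h1 : 1 ∈ G) (hs : IsCoarsestSupp G s) {a b : Fin n} (hab : a ≠ b)
    (ha : {a} ∈ s.classes) : Equiv.swap a b ∉ G := by
  intro hG
  let f : Fin n → Fin n := fun x => if x = b then a else x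
  let t : Setoid (Fin n) := Setoid.ker f
  have ht : IsSupporting G t := by
    intro π hπ
    have hf : ∀ x, f (π x) = f x := by
      intro x
      have hx := hπ {y | t y x} (Setoid.mem_classes t x)
      have : π x ∈ {y | t y x} := by
        rw [← hx]
        exact ⟨x, t.refl x, rfl⟩
      exact this
    have hfix : ∀ x, x ≠ a → x ≠ b → π x = x := by
      intro x hxa hxb
      have := hf x
      simp only [f, hxb, if_false] at this
      split_ifs at this with h2
      · exact absurd this.symm hxa
      · exact this
    have hpa : π a = a ∨ π a = b := by
      have := hf a
      simp only [f, hab, if_false] at this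
      split_ifs at this with h2
      · exact Or.inr h2
      · exact Or.inl this
    have hpb : π b = a ∨ π b = b := by
      have := hf b
      simp only [f, if_true] at this
      split_ifs at this with h2
      · exact Or.inr h2
      · exact Or.inl this
    have hne : π a ≠ π b := fun e => hab (π.injective e)
    by_cases hc : π a = a
    · have : π = 1 := by
        ext1 x
        by_cases hxa : x = a
        · simp [hxa, hc]
        · by_cases hxb : x = b
          · subst hxb
            rcases hpb with h | h
            · exact absurd (hc.trans h.symm) hne
            · simp [h]
          · simp [hfix x hxa hxb]
      rwa [this]
    · have hc' : π a = b := hpa.resolve_left hc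
      have : π = Equiv.swap a b := by
        ext1 x
        by_cases hxa : x = a
        · simp [hxa, hc']
        · by_cases hxb : x = b
          · subst hxb
            rcases hpb with h | h
            · simp [h]
            · exact absurd (hc'.trans h.symm) hne
          · rw [hfix x hxa hxb, Equiv.swap_apply_of_ne_of_ne hxa hxb]
      rwa [this]
  obtain ⟨Q, hQ, hPQ⟩ := hs.2 t ht {y | t y a} (Setoid.mem_classes t a)
  have haQ : a ∈ Q := hPQ (t.refl a)
  have hbQ : b ∈ Q := hPQ (show f b = f a by simp [f])
  have hQa : Q = {a} := Setoid.eq_of_mem_classes hQ haQ ha rfl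
  rw [hQa] at hbQ
  exact hab hbQ.symm

/-- Bochert-style argument: a large set of singleton positions on which no nontrivial
element of the stabiliser is supported. -/
theorem aux_bochert {n : ℕ} (B : Set (Str n)) (s : Setoid (Fin n))
    (hs : IsCoarsestSupp (setStab B) s) :
    ∃ Γ : Finset (Fin n), ({k : Fin n | {k} ∈ s.classes}).ncard ≤ 2 * Γ.card ∧
      ∀ g ∈ setStab B, (∀ x, x ∉ Γ → g x = x) → g = 1 := by
  classical
  let S : Finset (Fin n) := Finset.univ.filter fun k => {k} ∈ s.classes
  have hS : ({k : Fin n | {k} ∈ s.classes}).ncard = S.card := by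
    rw [← Set.ncard_coe_finset]
    congr 1
    ext; simp [S]
  let good : Finset (Fin n) → Prop := fun Γ =>
    ∀ g ∈ setStab B, (∀ x, x ∉ Γ → g x = x) → g = 1
  let F := S.powerset.filter good
  have hF : F.Nonempty := by
    refine ⟨∅, ?_⟩
    simp only [F, Finset.mem_filter, Finset.empty_mem_powerset, true_and]
    intro g _ hg
    ext1 x
    simp [hg x]
  obtain ⟨Γ, hΓ, hmax⟩ := Finset.exists_max_image F Finset.card hF
  simp only [F, Finset.mem_filter, Finset.mem_powerset] at hΓ hmax
  refine ⟨Γ, ?_, hΓ.2⟩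
  rw [hS]
  by_contra hlt
  have hcard : (S \ Γ).card + Γ.card = S.card := Finset.card_sdiff_add_card_eq_card hΓ.1
  have hb1 : ¬ good (S \ Γ) := by
    intro hg
    have := hmax (S \ Γ) ⟨Finset.sdiff_subset, hg⟩
    omega
  simp only [good, not_forall] at hb1
  obtain ⟨g, hgB, hgs, hg1⟩ := hb1
  have : ∃ a, g a ≠ a := by
    by_contra hcon
    push Not at hcon
    exact hg1 (Equiv.ext hcon)
  obtain ⟨a, hga⟩ := this
  have haS : a ∈ S \ Γ := by
    by_contra hcon
    exact hga (hgs a hcon)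
  rw [Finset.mem_sdiff] at haS
  have hb2 : ¬ good (insert a Γ) := by
    intro hg
    have := hmax (insert a Γ) ⟨Finset.insert_subset haS.1 hΓ.1, hg⟩
    rw [Finset.card_insert_of_notMem haS.2] at this
    omega
  simp only [good, not_forall] at hb2
  obtain ⟨h, hhB, hhs, hh1⟩ := hb2
  have hha : h a ≠ a := by
    intro e
    apply hh1
    apply hΓ.2 h hhB
    intro x hx
    by_cases hxa : x = a
    · rw [hxa, e]
    · exact hhs x (by simp [hx, hxa])
  have hd : ∀ x, x ≠ a → g x = x ∨ h x = x := by
    intro x hxa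
    by_cases hx : x ∈ Γ
    · left
      exact hgs x (by simp [hx])
    · right
      exact hhs x (by simp [hx, hxa])
  obtain ⟨hcomm, hne⟩ := aux_commutator g h a hga hha hd
  have hmem := aux_mul_mem (aux_mul_mem (aux_mul_mem hgB hhB) (aux_inv_mem hgB))
    (aux_inv_mem hhB)
  rw [hcomm] at hmem
  have hsw := aux_swap_mem hga.symm hne hha.symm hmem
  have haC : {a} ∈ s.classes := by simpa [S] using haS.1
  exact aux_no_swap (aux_one_mem B) hs hga.symm haC hsw

theorem aux_orbit {n : ℕ} (B : Set (Str n)) (Γ : Finset (Fin n))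
    (hΓ : ∀ g ∈ setStab B, (∀ x, x ∉ Γ → g x = x) → g = 1) :
    Γ.card.factorial ≤ (setOrbit B).ncard := by
  classical
  let φ : Equiv.Perm {x // x ∈ Γ} → Set (Str n) := fun σ => actSet (Equiv.Perm.ofSubtype σ) B
  have hinj : Function.Injective φ := by
    intro σ τ hst
    have hmem : (Equiv.Perm.ofSubtype (σ⁻¹ * τ) : Equiv.Perm (Fin n)) ∈ setStab B := by
      have hst' : actSet (Equiv.Perm.ofSubtype σ) B = actSet (Equiv.Perm.ofSubtype τ) B := hst
      simp only [setStab, Set.mem_ofPred_eq]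
      rw [map_mul, aux_actSet_mul, ← hst', ← aux_actSet_mul, ← map_mul]
      simp [aux_actSet_one]
    have := hΓ _ hmem (fun x hx => Equiv.Perm.ofSubtype_apply_of_not_mem _ hx)
    have h2 : σ⁻¹ * τ = 1 := Equiv.Perm.ofSubtype_injective (by rw [this, map_one])
    exact (inv_mul_eq_one.mp h2)
  have hr : Set.range φ ⊆ setOrbit B := by
    rintro _ ⟨σ, rfl⟩
    exact ⟨_, rfl⟩
  calc Γ.card.factorial = Nat.card (Equiv.Perm {x // x ∈ Γ}) := by
        rw [Nat.card_eq_fintype_card, Fintype.card_perm, Fintype.card_coe]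
    _ = (Set.range φ).ncard := by
        rw [← Set.image_univ, Set.ncard_image_of_injective _ hinj, Set.ncard_univ]
    _ ≤ _ := Set.ncard_le_ncard hr (Set.toFinite _)

/-- if `|B_n| ≤ c·n` and the number of singleton parts of `SP(B_n)` is
at least `δ·n` for sufficiently large `n`, then `|Orbit_n(B_n)|` grows faster than
any polynomial in `2ⁿ`. -/
theorem stmt_19 (c δ : ℝ) (hc : 0 < c) (hδ : 0 < δ)
    (B : ∀ n, Set (Str n))
    (sp : ∀ n, Setoid (Fin n))
    (hsp : ∀ n, IsCoarsestSupp (setStab (B n)) (sp n))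
    (h : ∃ N, ∀ n ≥ N, ((B n).ncard : ℝ) ≤ c * n ∧
        δ * n ≤ (({k : Fin n | {k} ∈ (sp n).classes}).ncard : ℝ)) :
    ∀ (k : ℕ) (C : ℝ), 0 < C → ∃ n, C * (2 : ℝ) ^ (k * n) < ((setOrbit (B n)).ncard : ℝ) := by
  intro k C hC
  obtain ⟨N, hN⟩ := h
  obtain ⟨q, hq⟩ := exists_nat_ge (2 / δ)
  have hlim := FloorSemiring.tendsto_pow_div_factorial_atTop ((2 : ℝ) ^ (k * q))
  have hev := hlim.eventually (gt_mem_nhds (show (0 : ℝ) < 1 / C by positivity))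
  obtain ⟨M, hM⟩ := Filter.eventually_atTop.mp hev
  obtain ⟨M', hM'⟩ := exists_nat_ge (2 * (M : ℝ) / δ)
  obtain ⟨n, hn1, hn2⟩ : ∃ n, N ≤ n ∧ M' ≤ n := ⟨max N M', le_max_left _ _, le_max_right _ _⟩
  refine ⟨n, ?_⟩
  obtain ⟨Γ, hΓ1, hΓ2⟩ := aux_bochert (B n) (sp n) (hsp n)
  have horb := aux_orbit (B n) Γ hΓ2
  have hcard : δ * n ≤ 2 * (Γ.card : ℝ) :=
    (hN n hn1).2.trans (by exact_mod_cast hΓ1)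
  have hMn : 2 * (M : ℝ) ≤ δ * n := by
    have h1 : 2 * (M : ℝ) / δ ≤ n := hM'.trans (by exact_mod_cast hn2)
    rw [div_le_iff₀ hδ] at h1
    linarith
  have hMc : M ≤ Γ.card := by
    have : (M : ℝ) ≤ Γ.card := by linarith
    exact_mod_cast this
  have hnq : n ≤ q * Γ.card := by
    have h2 : 2 ≤ q * δ := by rwa [div_le_iff₀ hδ] at hq
    have h3 : (n : ℝ) ≤ q * Γ.card := by
      have h4 : (q : ℝ) * (δ * n) ≤ q * (2 * Γ.card) := by gcongr
      have h5 : 2 * (n : ℝ) ≤ q * δ * n := by gcongr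
      linarith
    exact_mod_cast h3
  have hlt := hM Γ.card hMc
  have hfac : (0 : ℝ) < (Γ.card.factorial : ℝ) := by exact_mod_cast Nat.factorial_pos _
  rw [div_lt_div_iff₀ hfac hC] at hlt
  calc C * (2 : ℝ) ^ (k * n) ≤ C * (2 : ℝ) ^ (k * q * Γ.card) := by
        refine mul_le_mul_of_nonneg_left (pow_le_pow_right₀ (by norm_num) ?_) hC.le
        rw [mul_assoc]
        exact Nat.mul_le_mul_left k hnq
    _ < (Γ.card.factorial : ℝ) := by
        rw [pow_mul]
        linarith
    _ ≤ _ := by exact_mod_cast horb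
end
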